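/- Let R = ⊕_{i≥0} R_i be a graded commutative Noetherian ring and P a finitely generated projective R-module. Let J be an ideal of R₀ contained in the Quillen ideal Q(P, R₀). If p ∈ P is such that the image of p in P_{1+R⁺} is unimodular and the image of p in P_{1+J} is unimodular, where R⁺ = ⊕_{i≥1} R_i, then P contains a unimodular element p₁ with p₁ ≡ p modulo R⁺P. -/

import Mathlib

set_option synthInstance.maxHeartbeats 1000000
set_option maxHeartbeats 1000000

/-- The multiplicative set `1 + I = {1 + a : a ∈ I}` attached to an ideal `I`. -/
def oneAddSet {R : Type*} [CommRing R] (I : Ideal R) : Submonoid R where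
  carrier := {x | ∃ a ∈ I, x = 1 + a}
  one_mem' := ⟨0, I.zero_mem, by ring⟩
  mul_mem' := by
    rintro x y ⟨a, ha, rfl⟩ ⟨b, hb, rfl⟩
    exact ⟨a + b + a * b, add_mem (add_mem ha hb) (I.mul_mem_right b ha), by ring⟩

/-- The multiplicative set `1 + J ⊆ R` attached to an ideal `J` of a subring `R₀ ⊆ R`
(here the degree-zero part of a grading). -/
def oneAddSubIdeal {R : Type*} [CommRing R] (𝒜 : ℕ → AddSubgroup R) [GradedRing 𝒜]
    (J : Ideal (𝒜 0)) : Submonoid R where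
  carrier := {x | ∃ a ∈ J, x = 1 + (a : R)}
  one_mem' := ⟨0, J.zero_mem, by simp⟩
  mul_mem' := by
    rintro x y ⟨a, ha, rfl⟩ ⟨b, hb, rfl⟩
    refine ⟨a + b + a * b, add_mem (add_mem ha hb) (J.mul_mem_right b ha), ?_⟩
    push_cast
    ring

/-- A unimodular element of a module. -/
def IsUnimodular {R P : Type*} [CommRing R] [AddCommGroup P] [Module R P] (p : P) : Prop :=
  ∃ φ : P →ₗ[R] R, φ p = 1

section
open Polynomial
variable {R : Type*} [CommRing R] (𝒜 : ℕ → AddSubgroup R) [GradedRing 𝒜]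

/-- The ring homomorphism `R → R[X]` sending `a ∈ R_i` to `a X ^ i`. -/
noncomputable def gradedToPolynomial : R →+* R[X] :=
  (DirectSum.toSemiring (fun i => (monomial i).toAddMonoidHom.comp (𝒜 i).subtype)
    rfl (fun a b => by simp [monomial_mul_monomial])).comp
    (DirectSum.decomposeRingEquiv 𝒜 : R →+* _)

lemma gradedToPolynomial_of_mem {i : ℕ} {a : R} (ha : a ∈ 𝒜 i) :
    gradedToPolynomial 𝒜 a = monomial i a := by
  lift a to 𝒜 i using ha
  have h : DirectSum.decomposeRingEquiv 𝒜 (a : R) = DirectSum.of (fun i => 𝒜 i) i a :=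
    DirectSum.decompose_coe 𝒜 a
  rw [gradedToPolynomial, RingHom.comp_apply, RingHom.coe_coe, h]
  exact DirectSum.toSemiring_of _ _ _ _ _

lemma coeff_gradedToPolynomial (a : R) (i : ℕ) :
    (gradedToPolynomial 𝒜 a).coeff i = (DirectSum.decompose 𝒜 a i : R) := by
  induction a using DirectSum.Decomposition.inductionOn 𝒜 with
  | zero => simp
  | add a b ha hb => simp [ha, hb]
  | @homogeneous j a =>
    rw [gradedToPolynomial_of_mem 𝒜 a.2, coeff_monomial]
    split_ifs with h
    · subst h; simp
    · rw [DirectSum.decompose_of_mem_ne 𝒜 a.2 h]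

/-- The ring endomorphism of a graded ring sending `a ∈ R_i` to `c ^ i * a`. -/
noncomputable def gradedScale (c : R) : R →+* R :=
  (evalRingHom c).comp (gradedToPolynomial 𝒜)

lemma gradedScale_of_mem {i : ℕ} {a : R} (ha : a ∈ 𝒜 i) (c : R) :
    gradedScale 𝒜 c a = c ^ i * a := by
  simp [gradedScale, gradedToPolynomial_of_mem 𝒜 ha, mul_comm]

lemma gradedScale_of_mem_zero {a : R} (ha : a ∈ 𝒜 0) (c : R) :
    gradedScale 𝒜 c a = a := by
  simp [gradedScale_of_mem 𝒜 ha]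

lemma gradedScale_one : gradedScale 𝒜 1 = RingHom.id R := by
  ext a
  induction a using DirectSum.Decomposition.inductionOn 𝒜 with
  | zero => simp
  | add a b ha hb => simp_all
  | homogeneous a => simp [gradedScale_of_mem 𝒜 a.2]

lemma gradedScale_zero_of_mem_irrelevant {a : R}
    (ha : a ∈ (HomogeneousIdeal.irrelevant 𝒜).toIdeal) : gradedScale 𝒜 0 a = 0 := by
  have : (DirectSum.decompose 𝒜 a 0 : R) = 0 := ha
  rw [← coeff_gradedToPolynomial, coeff_zero_eq_eval_zero] at this
  exact this

lemma mem_irrelevant_of_mem {i : ℕ} (hi : i ≠ 0) {a : R} (ha : a ∈ 𝒜 i) :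
    a ∈ (HomogeneousIdeal.irrelevant 𝒜).toIdeal :=
  DirectSum.decompose_of_mem_ne 𝒜 ha hi

lemma exists_gradedScale_sub (c c' a : R) :
    ∃ h ∈ (HomogeneousIdeal.irrelevant 𝒜).toIdeal,
      gradedScale 𝒜 c' a = gradedScale 𝒜 c a + (c' - c) * h := by
  induction a using DirectSum.Decomposition.inductionOn 𝒜 with
  | zero => exact ⟨0, zero_mem _, by simp⟩
  | add a b ha hb =>
    obtain ⟨h, hh, e⟩ := ha
    obtain ⟨k, hk, f⟩ := hb
    exact ⟨h + k, add_mem hh hk, by rw [map_add, map_add, e, f]; ring⟩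
  | @homogeneous i a =>
    rcases eq_or_ne i 0 with rfl | hi
    · exact ⟨0, zero_mem _, by simp [gradedScale_of_mem_zero 𝒜 a.2]⟩
    · obtain ⟨k, hk⟩ := sub_dvd_pow_sub_pow c' c i
      refine ⟨k * a, Ideal.mul_mem_left _ _ (mem_irrelevant_of_mem 𝒜 hi a.2), ?_⟩
      rw [gradedScale_of_mem 𝒜 a.2, gradedScale_of_mem 𝒜 a.2]
      linear_combination (a : R) * hk

lemma sum_gradedScale_mul_gradedScale_eq_zero {L : Type*} [Fintype L] {b x : L → R}
    (h : ∀ i, ∑ l, b l * (DirectSum.decompose 𝒜 (x l) i : R) = 0) (c c' : R) :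
    ∑ l, gradedScale 𝒜 c (b l) * gradedScale 𝒜 c' (x l) = 0 := by
  have key (i : ℕ) : ∑ l, gradedScale 𝒜 c (b l) * (DirectSum.decompose 𝒜 (x l) i : R) = 0 := by
    have h1 := congrArg (gradedToPolynomial 𝒜) (h i)
    simp only [map_sum, map_mul, map_zero,
      gradedToPolynomial_of_mem 𝒜 (SetLike.coe_mem (DirectSum.decompose 𝒜 _ i)),
      ← C_mul_X_pow_eq_monomial, ← mul_assoc] at h1
    rw [← Finset.sum_mul] at h1
    have h2 := congrArg (eval c) ((Polynomial.isRegular_X_pow i).right.mul_right_eq_zero_iff.1 h1)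
    simpa [eval_finsetSum, gradedScale] using h2
  have h3 : ∑ l, C (gradedScale 𝒜 c (b l)) * gradedToPolynomial 𝒜 (x l) = 0 := by
    ext i
    simpa only [finsetSum_coeff, coeff_C_mul, coeff_zero, coeff_gradedToPolynomial] using key i
  simpa [eval_finsetSum, gradedScale] using congrArg (eval c') h3
lemma exists_map_gradedScale_sub {m n : Type*} (M : Matrix m n R) (c c' : R) :
    ∃ H : Matrix m n R, (∀ i j, H i j ∈ (HomogeneousIdeal.irrelevant 𝒜).toIdeal) ∧
      M.map (gradedScale 𝒜 c') = M.map (gradedScale 𝒜 c) + (c' - c) • H := by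
  choose H hH h using fun i j => exists_gradedScale_sub 𝒜 c c' (M i j)
  exact ⟨Matrix.of H, hH, by ext i j; simp [h]⟩
end

section
open TensorProduct
variable {R n : Type*} [CommRing R] [Fintype n]

/-- The image of the idempotent matrix `e` embeds as a direct summand into the image of `f`,
by a map congruent to `e` modulo `I`. -/
def SplitEmbedsModulo (I : Ideal R) (e f : Matrix n n R) : Prop :=
  ∃ α β : Matrix n n R, β * α = e ∧ f * α = α ∧ ∀ i j, (α - e) i j ∈ I

lemma SplitEmbedsModulo.refl {I : Ideal R} {e : Matrix n n R} (he : e * e = e) :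
    SplitEmbedsModulo I e e :=
  ⟨e, e, he, he, by simp⟩

lemma SplitEmbedsModulo.trans {I : Ideal R} {e f g : Matrix n n R}
    (h₁ : SplitEmbedsModulo I e f) (h₂ : SplitEmbedsModulo I f g) :
    SplitEmbedsModulo I e g := by
  obtain ⟨α, β, hβα, hfα, hα⟩ := h₁
  obtain ⟨α', β', hβα', hfα', hα'⟩ := h₂
  refine ⟨α' * α, β * β', ?_, ?_, fun i j => ?_⟩
  · rw [Matrix.mul_assoc, ← Matrix.mul_assoc β', hβα', hfα, hβα]
  · rw [← Matrix.mul_assoc, hfα']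
  · have : α' * α - e = (α' - f) * α + (α - e) := by
      rw [Matrix.sub_mul, hfα]; abel
    rw [this, Matrix.add_apply, Matrix.mul_apply]
    exact add_mem (sum_mem fun k _ => I.mul_mem_right _ (hα' i k)) (hα i j)

variable (𝒜 : ℕ → AddSubgroup R) [GradedRing 𝒜]

lemma map_gradedScale_mul {l m n : Type*} [Fintype m] (M : Matrix l m R) (N : Matrix m n R)
    (c : R) : (M * N).map (gradedScale 𝒜 c) = M.map (gradedScale 𝒜 c) * N.map (gradedScale 𝒜 c) :=
  Matrix.map_mul

/-- The ideal of all `d` such that the pullbacks of the image of the idempotent matrix `e` along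
the graded scalings by `c` and `c + d * z` are linked by a split embedding, for all `c` and `z`. -/
def linkingIdeal {e : Matrix n n R} (he : e * e = e) : Ideal R where
  carrier := {d | ∀ c z : R, SplitEmbedsModulo (HomogeneousIdeal.irrelevant 𝒜).toIdeal
    (e.map (gradedScale 𝒜 c)) (e.map (gradedScale 𝒜 (c + d * z)))}
  zero_mem' c z := by
    rw [zero_mul, add_zero]
    exact .refl (by rw [← map_gradedScale_mul, he])
  add_mem' {d d'} h h' c z := by
    have := (h c z).trans (h' (c + d * z) z)
    rwa [add_assoc, ← add_mul] at this
  smul_mem' r d h c z := by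
    have := h c (r * z)
    rwa [← mul_assoc, mul_comm d] at this

lemma exists_pow_torsion_bound [IsNoetherianRing R] (s : R) :
    ∃ K : ℕ, ∀ k : ℕ, ∀ z : R, s ^ k * z = 0 → s ^ K * z = 0 := by
  obtain ⟨K, hK⟩ := monotone_stabilizes_iff_noetherian.mpr (inferInstance : IsNoetherian R R)
    (LinearMap.mulLeft R s).iterateKer
  have hker (k : ℕ) (z : R) : z ∈ (LinearMap.mulLeft R s).iterateKer k ↔ s ^ k * z = 0 := by
    change z ∈ LinearMap.ker (LinearMap.mulLeft R s ^ k) ↔ _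
    simp [LinearMap.pow_mulLeft]
  refine ⟨K, fun k z hz => ?_⟩
  rcases le_total k K with h | h
  · rw [← Nat.sub_add_cancel h, pow_add, mul_assoc, hz, mul_zero]
  · rwa [← hker, hK k h, hker]

lemma pow_mem_linkingIdeal [IsNoetherianRing R] {L : Type*} [Fintype L]
    {e : Matrix n n R} (he : e * e = e) {s : R} (hs : s ∈ 𝒜 0) {m : ℕ}
    (A : Matrix L n R) (B : Matrix n L R) (hBA : B * A = s ^ m • e) (heB : e * B = B)
    (hX : ∀ c c' : R, B.map (gradedScale 𝒜 c) * A.map (gradedScale 𝒜 c') *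
      B.map (gradedScale 𝒜 c') = s ^ m • B.map (gradedScale 𝒜 c)) :
    ∃ N, s ^ N ∈ linkingIdeal 𝒜 he := by
  obtain ⟨K, hK⟩ := exists_pow_torsion_bound s
  have tors (k : ℕ) (Z : Matrix n n R) (h : s ^ k • Z = 0) : s ^ K • Z = 0 := by
    ext i j
    exact hK k _ (congrFun (congrFun h i) j)
  refine ⟨K + m, fun c z => ?_⟩
  set c' := c + s ^ (K + m) * z with hc'
  have hcc' : c' - c = s ^ m * (s ^ K * z) := by rw [hc']; ring
  obtain ⟨H, hH, hBH⟩ := exists_map_gradedScale_sub 𝒜 B c c'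
  obtain ⟨E, -, hE⟩ := exists_map_gradedScale_sub 𝒜 e c c'
  have hsm (x : R) (M : Matrix n n R) :
      (s ^ m • M).map (gradedScale 𝒜 x) = s ^ m • M.map (gradedScale 𝒜 x) := by
    ext i j
    simp [gradedScale_of_mem_zero 𝒜 hs]
  have hBAx (x : R) : B.map (gradedScale 𝒜 x) * A.map (gradedScale 𝒜 x) =
      s ^ m • e.map (gradedScale 𝒜 x) := by
    rw [← map_gradedScale_mul, hBA, hsm]
  have hee (x : R) : e.map (gradedScale 𝒜 x) * e.map (gradedScale 𝒜 x) =
      e.map (gradedScale 𝒜 x) := by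
    rw [← map_gradedScale_mul, he]
  have heBx (x : R) : e.map (gradedScale 𝒜 x) * B.map (gradedScale 𝒜 x) =
      B.map (gradedScale 𝒜 x) := by
    rw [← map_gradedScale_mul, heB]
  have hXc := hX c c'
  have hA₁ := hBAx c
  have hA₂ := hBAx c'
  have he₁ := hee c
  have he₂ := heBx c'
  generalize e.map (gradedScale 𝒜 c) = e₁ at *
  generalize e.map (gradedScale 𝒜 c') = e₂ at *
  generalize B.map (gradedScale 𝒜 c) = B₁ at *
  generalize B.map (gradedScale 𝒜 c') = B₂ at *
  generalize A.map (gradedScale 𝒜 c) = A₁ at *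
  generalize A.map (gradedScale 𝒜 c') = A₂ at *
  rw [hcc'] at hBH hE
  have hα : s ^ m • (e₁ + s ^ K • z • (H * A₁)) = B₂ * A₁ := by
    rw [hBH, Matrix.add_mul, hA₁, Matrix.smul_mul, smul_add, smul_smul, smul_smul,
      ← mul_assoc]
  have hβ : s ^ m • (e₂ - s ^ K • z • (H * A₂)) = B₁ * A₂ := by
    rw [eq_sub_of_add_eq hBH.symm, Matrix.sub_mul, hA₂, Matrix.smul_mul, smul_sub, smul_smul,
      smul_smul, ← mul_assoc]
  refine ⟨e₁ + s ^ K • z • (H * A₁), e₂ - s ^ K • z • (H * A₂), ?_, ?_, fun i j => ?_⟩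
  · have h₁ : s ^ (m + m) • ((e₂ - s ^ K • z • (H * A₂)) * (e₁ + s ^ K • z • (H * A₁))) =
        s ^ (m + m) • e₁ := by
      rw [pow_add, mul_smul, ← Matrix.mul_smul, ← Matrix.smul_mul, hα, hβ, ← Matrix.mul_assoc,
        hXc, Matrix.smul_mul, hA₁, smul_smul]
    have h₂ : (e₂ - s ^ K • z • (H * A₂)) * (e₁ + s ^ K • z • (H * A₁)) - e₁ =
        s ^ K • ((s ^ m * z) • (E * e₁) + z • (e₂ * (H * A₁))
          - z • (H * A₂ * e₁) - (z * (s ^ K * z)) • (H * A₂ * (H * A₁))) := by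
      have : e₂ * e₁ = e₁ + s ^ K • (s ^ m * z) • (E * e₁) := by
        rw [hE, Matrix.add_mul, he₁, Matrix.smul_mul, smul_smul]
        congr 2
        ring
      rw [Matrix.sub_mul, Matrix.mul_add, Matrix.mul_add, this]
      simp only [Matrix.smul_mul, Matrix.mul_smul]
      module
    rw [← sub_eq_zero, h₂]
    refine tors (m + m + K) _ ?_
    rw [pow_add, mul_smul, ← h₂, smul_sub, h₁, sub_self]
  · have h₁ : s ^ m • (e₂ * (e₁ + s ^ K • z • (H * A₁))) =
        s ^ m • (e₁ + s ^ K • z • (H * A₁)) := by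
      rw [← Matrix.mul_smul, hα, ← Matrix.mul_assoc, he₂]
    have h₂ : e₂ * (e₁ + s ^ K • z • (H * A₁)) - (e₁ + s ^ K • z • (H * A₁)) =
        s ^ K • ((s ^ m * z) • (E * e₁) + z • (e₂ * (H * A₁)) - z • (H * A₁)) := by
      have : e₂ * e₁ = e₁ + s ^ K • (s ^ m * z) • (E * e₁) := by
        rw [hE, Matrix.add_mul, he₁, Matrix.smul_mul, smul_smul]
        congr 2
        ring
      rw [Matrix.mul_add, this]
      simp only [Matrix.mul_smul]
      module
    rw [← sub_eq_zero, h₂]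
    refine tors (m + K) _ ?_
    rw [pow_add, mul_smul, ← h₂, smul_sub, h₁, sub_self]
  · rw [add_sub_cancel_left, Matrix.smul_apply, Matrix.smul_apply, Matrix.mul_apply]
    exact Ideal.mul_mem_left _ _ (Ideal.mul_mem_left _ _
      (sum_mem fun k _ => Ideal.mul_mem_right _ _ (hH i k)))

/-- The projection of a graded ring onto `R_i`, as an `R₀`-linear map. -/
noncomputable def gradedProjZeroLinear [Algebra (𝒜 0) R]
    (halg : ∀ a : 𝒜 0, algebraMap (𝒜 0) R a = (a : R)) (i : ℕ) : R →ₗ[𝒜 0] R where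
  toFun a := DirectSum.decompose 𝒜 a i
  map_add' a b := by simp
  map_smul' a b := by
    rw [Algebra.smul_def, halg, RingHom.id_apply, Algebra.smul_def, halg,
      DirectSum.coe_decompose_mul_of_left_mem_zero 𝒜 a.2]

lemma sum_decompose_tmul_eq_zero [Algebra (𝒜 0) R]
    (halg : ∀ a : 𝒜 0, algebraMap (𝒜 0) R a = (a : R)) {N L : Type*} [AddCommGroup N]
    [Module (𝒜 0) N] [Fintype L] {x : L → R} {ν : L → N}
    (h : ∑ l, x l ⊗ₜ[𝒜 0] ν l = 0) (i : ℕ) :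
    ∑ l, (DirectSum.decompose 𝒜 (x l) i : R) ⊗ₜ[𝒜 0] ν l = 0 := by
  simpa [gradedProjZeroLinear] using
    congrArg ((gradedProjZeroLinear 𝒜 halg i).rTensor N) h

lemma exists_pow_smul_eq_zero_of_localized {M : Type*} [AddCommGroup M] [Module R M] {s : R}
    {x : M} (h : LocalizedModule.mkLinearMap (Submonoid.powers s) M x = 0) :
    ∃ k : ℕ, s ^ k • x = 0 := by
  obtain ⟨⟨_, k, rfl⟩, hk⟩ :=
    (IsLocalizedModule.eq_zero_iff (Submonoid.powers s) _).1 h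
  exact ⟨k, hk⟩

lemma exists_pow_mem_linkingIdeal [IsNoetherianRing R] [DecidableEq n] [Algebra (𝒜 0) R]
    (halg : ∀ a : 𝒜 0, algebraMap (𝒜 0) R a = (a : R))
    {P N : Type*} [AddCommGroup P] [Module R P] [Module.Finite R P] [Module.Projective R P]
    [AddCommGroup N] [Module (𝒜 0) N]
    {s : R} (hs : s ∈ 𝒜 0)
    (Φ : LocalizedModule (Submonoid.powers s) P ≃ₗ[R]
      LocalizedModule (Submonoid.powers s) (R ⊗[𝒜 0] N))
    {i : P →ₗ[R] n → R} {π : (n → R) →ₗ[R] P} (hπi : π ∘ₗ i = LinearMap.id)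
    (he : (i ∘ₗ π).toMatrix' * (i ∘ₗ π).toMatrix' = (i ∘ₗ π).toMatrix') :
    ∃ k, s ^ k ∈ linkingIdeal 𝒜 he := by
  classical
  have := Module.finitePresentation_of_projective R P
  obtain ⟨K, hK⟩ := exists_pow_torsion_bound s
  set ιP := LocalizedModule.mkLinearMap (Submonoid.powers s) P with hιP
  set ιM := LocalizedModule.mkLinearMap (Submonoid.powers s) (R ⊗[𝒜 0] N) with hιM
  have torsP {x : P} (hx : ιP x = 0) (j : n) : s ^ K * i x j = 0 := by
    obtain ⟨k, hk⟩ := exists_pow_smul_eq_zero_of_localized hx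
    refine hK k _ ?_
    rw [← smul_eq_mul, ← Pi.smul_apply, ← map_smul, hk, map_zero, Pi.zero_apply]
  obtain ⟨h, ⟨_, a, rfl⟩, hh⟩ := Module.FinitePresentation.exists_lift_of_isLocalizedModule
    (N' := LocalizedModule (Submonoid.powers s) (R ⊗[𝒜 0] N)) (Submonoid.powers s) ιM
    (Φ.toLinearMap ∘ₗ ιP)
  replace hh (x : P) : ιM (h x) = s ^ a • Φ (ιP x) := LinearMap.congr_fun hh x
  have hgen (x : R ⊗[𝒜 0] N) :
      x ∈ Submodule.span R (Set.range fun ν : N => (1 : R) ⊗ₜ[𝒜 0] ν) := by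
    induction x with
    | zero => exact zero_mem _
    | add x y hx hy => exact add_mem hx hy
    | tmul r ν =>
      rw [← mul_one r, ← smul_eq_mul, ← TensorProduct.smul_tmul']
      exact Submodule.smul_mem _ _ (Submodule.subset_span ⟨ν, rfl⟩)
  choose c hc using fun j : n =>
    Finsupp.mem_span_range_iff_exists_finsupp.1 (hgen (h (π (Pi.single j 1))))
  let T : Finset N := Finset.univ.biUnion fun j => (c j).support
  let q : (T → R) →ₗ[R] R ⊗[𝒜 0] N :=
    Fintype.linearCombination R fun l : T => (1 : R) ⊗ₜ[𝒜 0] (l : N)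
  have hq (x : T → R) : q x = ∑ l, x l ⊗ₜ[𝒜 0] (l : N) := by
    simp [q, Fintype.linearCombination_apply, TensorProduct.smul_tmul']
  let A : Matrix T n R := Matrix.of fun l j => c j l
  have hqA (x : n → R) : q (A.mulVec x) = h (π x) := by
    suffices q ∘ₗ A.toLin' = h ∘ₗ π from LinearMap.congr_fun this x
    refine LinearMap.pi_ext' fun j => LinearMap.ext_ring ?_
    simp only [LinearMap.comp_apply, LinearMap.single_apply, Matrix.toLin'_apply,
      Matrix.mulVec_single_one]
    rw [← hc j, Finsupp.sum_of_support_subset (s := T) _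
      (Finset.subset_biUnion_of_mem (fun j => (c j).support) (Finset.mem_univ j)) _ (by simp),
      ← Finset.sum_coe_sort]
    simp [q, Fintype.linearCombination_apply, A]
  obtain ⟨h', ⟨_, b, rfl⟩, hh'⟩ := Module.FinitePresentation.exists_lift_of_isLocalizedModule
    (N' := LocalizedModule (Submonoid.powers s) P) (Submonoid.powers s) ιP
    (Φ.symm.toLinearMap ∘ₗ ιM ∘ₗ q)
  replace hh' (x : T → R) : ιP (h' x) = s ^ b • Φ.symm (ιM (q x)) := LinearMap.congr_fun hh' x
  let B : Matrix n T R := (s ^ K • (i ∘ₗ h')).toMatrix'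
  have hB (x : T → R) : B.mulVec x = s ^ K • i (h' x) :=
    LinearMap.toMatrix'_mulVec _ _
  have hπi' (x : P) : π (i x) = x := LinearMap.congr_fun hπi x
  have hAB (x : T → R) : ∃ k : ℕ, q (s ^ k • (A.mulVec (i (h' x)) - s ^ (a + b) • x)) = 0 := by
    obtain ⟨k, hk⟩ := exists_pow_smul_eq_zero_of_localized (s := s)
      (x := q (A.mulVec (i (h' x)) - s ^ (a + b) • x)) (by
        rw [map_sub, map_sub, hqA, hπi', ← hιM, hh, hh', map_smul, map_smul, map_smul,
          Φ.apply_symm_apply, smul_smul, ← pow_add, sub_self])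
    exact ⟨k, by rw [map_smul, hk]⟩
  refine pow_mem_linkingIdeal 𝒜 he hs (m := K + (a + b)) A B ?_ ?_ fun c c' => ?_
  · refine Matrix.toLin'.injective (LinearMap.ext fun x => ?_)
    rw [Matrix.toLin'_apply, ← Matrix.mulVec_mulVec, hB, map_smul, Matrix.toLin'_toMatrix']
    ext j
    have := torsP (x := h' (A.mulVec x) - s ^ (a + b) • π x) (by
      rw [map_sub, hh', hqA, hh, map_smul, map_smul, Φ.symm_apply_apply, smul_smul, ← pow_add,
        add_comm b, sub_self]) j
    rw [map_sub, map_smul, Pi.sub_apply, Pi.smul_apply, smul_eq_mul, mul_sub, sub_eq_zero,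
      ← mul_assoc, ← pow_add] at this
    exact this
  · refine Matrix.toLin'.injective (LinearMap.ext fun x => ?_)
    rw [Matrix.toLin'_apply, ← Matrix.mulVec_mulVec, hB, LinearMap.toMatrix'_mulVec, map_smul,
      LinearMap.comp_apply, hπi', Matrix.toLin'_apply, hB]
  · have hsm (x : R) (M : Matrix T T R) :
        (s ^ (K + (a + b)) • M).map (gradedScale 𝒜 x) =
          s ^ (K + (a + b)) • M.map (gradedScale 𝒜 x) := by
      ext i j
      simp [gradedScale_of_mem_zero 𝒜 hs]
    let X : Matrix T T R := A * B - s ^ (K + (a + b)) • 1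
    have h0 : B.map (gradedScale 𝒜 c) * X.map (gradedScale 𝒜 c') = 0 := by
      ext j l
      refine sum_gradedScale_mul_gradedScale_eq_zero 𝒜 (b := B j) (x := fun t => X t l)
        (fun d => ?_) c c'
      let y : T → R := A.mulVec (i (h' (Pi.single l 1))) - s ^ (a + b) • Pi.single l 1
      have hy (t : T) : X t l = s ^ K * y t := by
        have : X.mulVec (Pi.single l 1) = s ^ K • y := by
          rw [Matrix.sub_mulVec, ← Matrix.mulVec_mulVec, hB, Matrix.mulVec_smul,
            Matrix.smul_mulVec, Matrix.one_mulVec, smul_sub, smul_smul, pow_add]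
        rw [Matrix.mulVec_single_one] at this
        exact congrFun this t
      let z : T → R := fun t => (DirectSum.decompose 𝒜 (y t) d : R)
      have hdec (k : ℕ) (t : T) :
          (DirectSum.decompose 𝒜 (s ^ k * y t) d : R) = s ^ k * z t :=
        DirectSum.coe_decompose_mul_of_left_mem_zero 𝒜 
          (by simpa using SetLike.pow_mem_graded k hs)
      have hz : ιM (q z) = 0 := by
        obtain ⟨k, hk⟩ := hAB (Pi.single l 1)
        rw [hq] at hk
        refine (IsLocalizedModule.eq_zero_iff (Submonoid.powers s) _).2 ⟨⟨_, k, rfl⟩, ?_⟩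
        change s ^ k • q z = 0
        rw [← map_smul, hq, ← sum_decompose_tmul_eq_zero 𝒜 halg hk d]
        exact Finset.sum_congr rfl fun t _ => congrArg (· ⊗ₜ[𝒜 0] (t : N)) (hdec k t).symm
      have hBz : B.mulVec z = 0 := by
        rw [hB]
        ext j
        exact torsP (by rw [hh', hz, map_zero, smul_zero]) j
      simp only [hy, hdec]
      have := congrFun hBz j
      rw [Matrix.mulVec, dotProduct, Pi.zero_apply] at this
      simp only [mul_left_comm _ (s ^ K), ← Finset.mul_sum, this, mul_zero]
    rw [Matrix.map_sub _ (map_sub _), hsm, map_gradedScale_mul,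
      Matrix.map_one _ (map_zero _) (map_one _), Matrix.mul_sub, Matrix.mul_smul, Matrix.mul_one,
      sub_eq_zero, ← Matrix.mul_assoc] at h0
    exact h0

lemma exists_linearMap_apply_mem {P : Type*} [AddCommGroup P] [Module R P] [Module.Finite R P]
    [Module.Projective R P] (S : Submonoid R) {p : P}
    (h : ∃ φ : LocalizedModule S P →ₗ[Localization S] Localization S,
      φ (LocalizedModule.mkLinearMap S P p) = 1) :
    ∃ ψ : P →ₗ[R] R, ψ p ∈ S := by
  have := Module.finitePresentation_of_projective R P
  obtain ⟨φ, hφ⟩ := h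
  obtain ⟨g, s, hg⟩ := Module.FinitePresentation.exists_lift_of_isLocalizedModule
    S (Algebra.linearMap R (Localization S))
    (φ.restrictScalars R ∘ₗ LocalizedModule.mkLinearMap S P)
  have hgp : algebraMap R (Localization S) (g p) = algebraMap R (Localization S) s := by
    refine (LinearMap.congr_fun hg p).trans ?_
    change (s : R) • φ (LocalizedModule.mkLinearMap S P p) = _
    rw [hφ, Algebra.algebraMap_eq_smul_one]
  obtain ⟨u, hu⟩ := IsLocalization.exists_of_eq (M := S) hgp
  refine ⟨(u : R) • g, ?_⟩
  rw [LinearMap.smul_apply, smul_eq_mul, hu]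
  exact S.mul_mem u.2 s.2

lemma apply_eq_dotProduct [DecidableEq n] {P : Type*} [AddCommGroup P] [Module R P]
    {i : P →ₗ[R] n → R} {π : (n → R) →ₗ[R] P} (hπi : π ∘ₗ i = LinearMap.id)
    (ψ : P →ₗ[R] R) (x : P) : ψ x = (fun j => ψ (π (Pi.single j 1))) ⬝ᵥ i x := by
  conv_lhs => rw [← LinearMap.id_apply (R := R) x, ← hπi, LinearMap.comp_apply,
    ← LinearMap.comp_apply, LinearMap.pi_apply_eq_sum_univ]
  simp only [dotProduct, smul_eq_mul, LinearMap.comp_apply, mul_comm]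
  congr! with j _ k
  simp [Pi.single_apply, eq_comm]

lemma apply_mem_smul_top {P : Type*} [AddCommGroup P] [Module R P] {I : Ideal R}
    (π : (n → R) →ₗ[R] P) {x : n → R} (hx : ∀ j, x j ∈ I) :
    π x ∈ I • (⊤ : Submodule R P) := by
  classical
  rw [LinearMap.pi_apply_eq_sum_univ]
  exact sum_mem fun j _ => Submodule.smul_mem_smul (hx j) trivial

lemma exists_dotProduct_gradedScale_eq_one {w x : R} (hw : w ∈ 𝒜 0) {v u₁ u₂ : n → R}
    (hu₁ : u₁ ⬝ᵥ v - 1 ∈ (HomogeneousIdeal.irrelevant 𝒜).toIdeal) (hu₂ : u₂ ⬝ᵥ v = w) :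
    ∃ u : n → R, u ⬝ᵥ (gradedScale 𝒜 (w * x) ∘ v) = 1 := by
  choose h _ hh using fun j => exists_gradedScale_sub 𝒜 0 (w * x) (v j)
  set v' := gradedScale 𝒜 (w * x) ∘ v with hv'
  have h₂ : (gradedScale 𝒜 (w * x) ∘ u₂) ⬝ᵥ v' = w := by
    rw [hv', ← RingHom.map_dotProduct, hu₂, gradedScale_of_mem_zero 𝒜 hw]
  have h₁ : (gradedScale 𝒜 0 ∘ u₁) ⬝ᵥ (gradedScale 𝒜 0 ∘ v) = 1 := by
    have := gradedScale_zero_of_mem_irrelevant 𝒜 hu₁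
    rwa [map_sub, map_one, sub_eq_zero, RingHom.map_dotProduct] at this
  have hv : v' = gradedScale 𝒜 0 ∘ v + (w * x) • h := by
    ext j
    simpa [hv'] using hh j
  refine ⟨gradedScale 𝒜 0 ∘ u₁ -
    (x * ((gradedScale 𝒜 0 ∘ u₁) ⬝ᵥ h)) • (gradedScale 𝒜 (w * x) ∘ u₂), ?_⟩
  rw [sub_dotProduct, smul_dotProduct, h₂, hv, dotProduct_add, h₁, dotProduct_smul]
  simp only [smul_eq_mul]
  ring

end

/-- Bhatwadekar–Lindel–Rao criterion: let `R = ⊕_{i ≥ 0} R_i` be a graded commutative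
Noetherian ring, `P` a finitely generated projective `R`-module, and `J` an ideal of
`R₀` contained in the Quillen ideal `Q(P, R₀)`.  If `p ∈ P` becomes unimodular in
`P_{1+R⁺}` and in `P_{1+J}`, then `P` contains a unimodular element `p₁` with
`p₁ ≡ p` modulo `R⁺P`. -/
theorem unimodular_lift_graded_criterion
    (R : Type) [CommRing R] [IsNoetherianRing R]
    (𝒜 : ℕ → AddSubgroup R) [GradedRing 𝒜]
    [alg : Algebra (𝒜 0) R] (halg : ∀ a : 𝒜 0, algebraMap (𝒜 0) R a = (a : R))
    (P : Type) [AddCommGroup P] [Module R P] [Module.Finite R P] [Module.Projective R P]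
    (J : Ideal (𝒜 0))
    -- `J` is contained in the Quillen ideal `Q(P, R₀)`, the ideal of `R₀` generated by
    -- those `s ∈ R₀` such that `P_s` is extended from `(R₀)_s`
    (hJQ : J ≤ Ideal.span {s : 𝒜 0 |
      ∃ (N : Type) (_ : AddCommGroup N) (_ : Module (𝒜 0) N),
        Nonempty (LocalizedModule (Submonoid.powers (s : R)) P
          ≃ₗ[Localization (Submonoid.powers (s : R))]
          LocalizedModule (Submonoid.powers (s : R)) (TensorProduct (𝒜 0) R N))})
    (p : P)
    (hplus : ∃ φ : LocalizedModule (oneAddSet (HomogeneousIdeal.irrelevant 𝒜).toIdeal) P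
        →ₗ[Localization (oneAddSet (HomogeneousIdeal.irrelevant 𝒜).toIdeal)]
        Localization (oneAddSet (HomogeneousIdeal.irrelevant 𝒜).toIdeal),
      φ (LocalizedModule.mkLinearMap (oneAddSet (HomogeneousIdeal.irrelevant 𝒜).toIdeal) P p) = 1)
    (hJloc : ∃ φ : LocalizedModule (oneAddSubIdeal 𝒜 J) P
        →ₗ[Localization (oneAddSubIdeal 𝒜 J)] Localization (oneAddSubIdeal 𝒜 J),
      φ (LocalizedModule.mkLinearMap (oneAddSubIdeal 𝒜 J) P p) = 1) :
    ∃ p₁ : P, IsUnimodular (R := R) p₁ ∧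
      (Submodule.Quotient.mk p₁ : P ⧸
          ((HomogeneousIdeal.irrelevant 𝒜).toIdeal • (⊤ : Submodule R P))) =
        Submodule.Quotient.mk p := by
  obtain ⟨m, π, i, -, -, hπi⟩ := Module.Finite.exists_comp_eq_id_of_projective R P
  have hπi' (x : P) : π (i x) = x := LinearMap.congr_fun hπi x
  set e := (i ∘ₗ π).toMatrix' with he_def
  have he_mulVec (x : Fin m → R) : e.mulVec x = i (π x) := LinearMap.toMatrix'_mulVec _ _
  have he : e * e = e := by
    rw [he_def, ← LinearMap.toMatrix'_comp]
    exact congrArg _ (LinearMap.ext fun x => congrArg i (hπi' (π x)))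
  have hJ : J ≤ (linkingIdeal 𝒜 he).radical.comap (algebraMap (𝒜 0) R) := by
    refine hJQ.trans (Ideal.span_le.2 ?_)
    rintro s ⟨N, _, _, ⟨Φ⟩⟩
    rw [SetLike.mem_coe, Ideal.mem_comap, halg]
    exact exists_pow_mem_linkingIdeal 𝒜 halg s.2 (Φ.restrictScalars R) hπi he
  obtain ⟨ψ₁, r, hr, hψ₁⟩ := exists_linearMap_apply_mem _ hplus
  obtain ⟨ψ₂, a, ha, hψ₂⟩ := exists_linearMap_apply_mem _ hJloc
  obtain ⟨k, hk⟩ := hJ ha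
  rw [halg] at hk
  obtain ⟨x, hx⟩ : 1 + (a : R) ∣ 1 - (-a : R) ^ k := by
    simpa using sub_dvd_pow_sub_pow (1 : R) (-a) k
  have hw : 1 + (a : R) ∈ 𝒜 0 := add_mem (SetLike.GradedOne.one_mem) a.2
  obtain ⟨u, hu⟩ := exists_dotProduct_gradedScale_eq_one 𝒜 (x := x) hw
    (u₁ := fun j => ψ₁ (π (Pi.single j 1))) (u₂ := fun j => ψ₂ (π (Pi.single j 1))) (v := i p)
    (by rwa [← apply_eq_dotProduct hπi, hψ₁, add_sub_cancel_left])
    (by rw [← apply_eq_dotProduct hπi, hψ₂])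
  rw [← hx] at hu
  set b := 1 - (-a : R) ^ k with hb
  obtain ⟨α, β, hβα, hα, hαI⟩ := hk b ((-1) ^ k)
  have hb1 : b + (a : R) ^ k * (-1) ^ k = 1 := by
    rw [hb, neg_pow (a : R)]
    ring
  rw [hb1, gradedScale_one, RingHom.coe_id, Matrix.map_id] at hα
  set v := gradedScale 𝒜 b ∘ i p with hv
  have hev : (e.map (gradedScale 𝒜 b)).mulVec v = v := by
    ext j
    rw [hv, ← RingHom.map_mulVec, he_mulVec, hπi', Function.comp_apply]
  have hiα : i (π (α.mulVec v)) = α.mulVec v := by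
    rw [← he_mulVec, Matrix.mulVec_mulVec, hα]
  refine ⟨π (α.mulVec v), ⟨Fintype.linearCombination R (Matrix.vecMul u β) ∘ₗ i, ?_⟩, ?_⟩
  · rw [LinearMap.comp_apply, hiα, Fintype.linearCombination_apply]
    change α.mulVec v ⬝ᵥ Matrix.vecMul u β = 1
    rw [dotProduct_comm, ← Matrix.dotProduct_mulVec, Matrix.mulVec_mulVec, hβα, hev, hu]
  · rw [Submodule.Quotient.eq]
    have hsub : π (α.mulVec v) - p = π (α.mulVec v - i p) := by rw [map_sub, hπi']
    rw [hsub]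
    refine apply_mem_smul_top π fun j => ?_
    obtain ⟨h, hI, hh⟩ := exists_gradedScale_sub 𝒜 1 b (i p j)
    have hvj : v j = i p j + (b - 1) * h := by
      rw [hv, Function.comp_apply, hh, gradedScale_one, RingHom.id_apply]
    have : (α.mulVec v - i p) j =
        (α - e.map (gradedScale 𝒜 b)).mulVec v j + (b - 1) * h := by
      rw [Matrix.sub_mulVec, hev, Pi.sub_apply, Pi.sub_apply, hvj]
      ring
    rw [this, Matrix.mulVec, dotProduct]
    exact add_mem (sum_mem fun l _ => Ideal.mul_mem_right _ _ (hαI j l))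
      (Ideal.mul_mem_left _ _ hI)
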